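/- (IDGI does not satisfy Linearity.) There exist n ≥ 1, N ≥ 1, a path of points x₀, …, x_N in ℝⁿ, differentiable functions f₁, f₂ : ℝⁿ → ℝ whose gradients are nonzero at every x_j, such that the gradient of f₁ + f₂ is nonzero at every x_j, and a feature index i, such that the IDGI attribution of feature i computed for f₁ + f₂ along the path is not equal to the sum of the IDGI attributions of feature i computed for f₁ and for f₂ along the same path. -/

import Mathlib

open RealInnerProductSpace

theorem gradient_inner_left {F : Type*} [NormedAddCommGroup F] [InnerProductSpace ℝ F]
    [CompleteSpace F] (a x : F) : gradient (fun y => inner ℝ a y) x = a := by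
  apply HasGradientAt.gradient
  rw [hasGradientAt_iff_hasFDerivAt]
  exact (innerSL ℝ a).hasFDerivAt

/-- IDGI does not satisfy Linearity: there are differentiable functions `f₁, f₂` with
nonzero gradients along a path such that the IDGI attribution of some feature for
`f₁ + f₂` differs from the sum of the IDGI attributions for `f₁` and `f₂`. -/
theorem idgi_not_linear :
    ∃ (n N : ℕ), 1 ≤ n ∧ 1 ≤ N ∧
      ∃ (x : ℕ → EuclideanSpace ℝ (Fin n))
        (f₁ f₂ : EuclideanSpace ℝ (Fin n) → ℝ),
        Differentiable ℝ f₁ ∧ Differentiable ℝ f₂ ∧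
        (∀ j < N, gradient f₁ (x j) ≠ 0) ∧
        (∀ j < N, gradient f₂ (x j) ≠ 0) ∧
        (∀ j < N, gradient (f₁ + f₂) (x j) ≠ 0) ∧
        ∃ i : Fin n,
          (∑ j ∈ Finset.range N,
              (gradient (f₁ + f₂) (x j) i) ^ 2 *
                ((f₁ + f₂) (x (j + 1)) - (f₁ + f₂) (x j)) /
                  ⟪gradient (f₁ + f₂) (x j), gradient (f₁ + f₂) (x j)⟫) ≠
            (∑ j ∈ Finset.range N,
                (gradient f₁ (x j) i) ^ 2 * (f₁ (x (j + 1)) - f₁ (x j)) /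
                  ⟪gradient f₁ (x j), gradient f₁ (x j)⟫) +
              (∑ j ∈ Finset.range N,
                  (gradient f₂ (x j) i) ^ 2 * (f₂ (x (j + 1)) - f₂ (x j)) /
                    ⟪gradient f₂ (x j), gradient f₂ (x j)⟫) := by
  have hadd : ((fun y => inner ℝ (!₂[1, 0] : EuclideanSpace ℝ (Fin 2)) y) +
      fun y => inner ℝ (!₂[0, 1] : EuclideanSpace ℝ (Fin 2)) y) =
      fun y => inner ℝ (!₂[1, 1] : EuclideanSpace ℝ (Fin 2)) y := by
    ext y
    simp [PiLp.inner_apply, Fin.sum_univ_two]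
  refine ⟨2, 1, by norm_num, le_rfl, fun j => !₂[(j : ℝ), 0],
    fun y => inner ℝ (!₂[1, 0] : EuclideanSpace ℝ (Fin 2)) y,
    fun y => inner ℝ (!₂[0, 1] : EuclideanSpace ℝ (Fin 2)) y,
    (innerSL ℝ _).differentiable, (innerSL ℝ _).differentiable, ?_, ?_, ?_, 0, ?_⟩
  · intro j _ h
    rw [gradient_inner_left] at h
    simpa using congrArg (fun v : EuclideanSpace ℝ (Fin 2) => v 0) h
  · intro j _ h
    rw [gradient_inner_left] at h
    simpa using congrArg (fun v : EuclideanSpace ℝ (Fin 2) => v 1) h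
  · intro j _ h
    rw [hadd, gradient_inner_left] at h
    simpa using congrArg (fun v : EuclideanSpace ℝ (Fin 2) => v 0) h
  · rw [hadd]
    simp only [gradient_inner_left]
    simp only [Finset.sum_range_one, PiLp.inner_apply, Fin.sum_univ_two]
    norm_num
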